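/- arXiv:1008.2138 — 3 statements merged into one kernel-verified Lean document; each statement's English description precedes it below -/
import Mathlib

section
/- (Modeling error of BQCE.) Let γ : ℤ → [0,1] be N-periodic, let α_ξ := (γ_ξ + γ_{ξ−1})/2 and β_ξ := 1 − (γ_{ξ+1} + γ_{ξ−1})/2, let y ∈ 𝒴 with min_ξ y'_ξ > 0, and set C̄_i := C_i(2 min_ξ y'_ξ). Then for every p ∈ [1,∞], ‖δΦ(y) − δΦ^bqce_γ(y)‖_{𝒰^{−1,p}} ≤ C̄₁ ‖Δ²α‖_{ℓ^p_ε} + ε C̄₂ ‖(Δβ_ξ · y''_ξ)_ξ‖_{ℓ^p_ε} + ε² ( C̄₂ ‖((1−β_{ξ−1}) y'''_ξ)_ξ‖_{ℓ^p_ε} + C̄₃ ‖((1−β_ξ)(y''_ξ)²)_ξ‖_{ℓ^p_ε} ). -/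
open scoped BigOperators ENNReal
open Finset

noncomputable section

/-- The lattice spacing `ε = 1/N`. -/
def eps (N : ℕ) : ℝ := (N : ℝ)⁻¹

/-- `u : ℤ → ℝ` is `N`-periodic. -/
def IsPeriodic (N : ℕ) (u : ℤ → ℝ) : Prop := ∀ ξ : ℤ, u (ξ + N) = u ξ

/-- Membership in the space `𝒰` of `N`-periodic mean-zero displacements. -/
def inU (N : ℕ) (u : ℤ → ℝ) : Prop :=
  IsPeriodic N u ∧ ∑ ξ ∈ Finset.Icc (1 : ℤ) (N : ℤ), u ξ = 0

/-- The uniform deformation `y^F_ξ = F ε ξ`. -/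
def yUnif (N : ℕ) (F : ℝ) : ℤ → ℝ := fun ξ => F * eps N * ξ

/-- Membership in the space `𝒴` of admissible deformations. -/
def inY (N : ℕ) (y : ℤ → ℝ) : Prop :=
  ∃ F : ℝ, 0 < F ∧ ∃ u : ℤ → ℝ, inU N u ∧ y = fun ξ => yUnif N F ξ + u ξ

/-- The discrete first derivative `y'_ξ = (y_ξ - y_{ξ-1})/ε`. -/
def d1 (N : ℕ) (y : ℤ → ℝ) (ξ : ℤ) : ℝ := (y ξ - y (ξ - 1)) / eps N

/-- The discrete second derivative `y''_ξ`. -/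
def d2 (N : ℕ) (y : ℤ → ℝ) (ξ : ℤ) : ℝ :=
  (y (ξ + 1) - 2 * y ξ + y (ξ - 1)) / (eps N) ^ 2

/-- The discrete third derivative `y'''_ξ`. -/
def d3 (N : ℕ) (y : ℤ → ℝ) (ξ : ℤ) : ℝ :=
  (y (ξ + 1) - 3 * y ξ + 3 * y (ξ - 1) - y (ξ - 2)) / (eps N) ^ 3

/-- The BQC energy `Φ_{α,β}`. -/
def PhiBQC (N : ℕ) (φ : ℝ → ℝ) (α β : ℤ → ℝ) (y : ℤ → ℝ) : ℝ :=
  eps N * ∑ ξ ∈ Finset.Icc (1 : ℤ) (N : ℤ),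
    (φ (d1 N y ξ) + α ξ * φ (2 * d1 N y ξ) + β ξ * φ (d1 N y ξ + d1 N y (ξ + 1)))

/-- The BQNL energy with blending function `η`. -/
def PhiBQNL (N : ℕ) (φ : ℝ → ℝ) (η : ℤ → ℝ) : (ℤ → ℝ) → ℝ :=
  PhiBQC N φ (fun ξ => 1 - (η ξ + η (ξ - 1)) / 2) η

/-- The BQCE energy with blending function `γ`. -/
def PhiBQCE (N : ℕ) (φ : ℝ → ℝ) (γ : ℤ → ℝ) : (ℤ → ℝ) → ℝ :=
  PhiBQC N φ (fun ξ => (γ ξ + γ (ξ - 1)) / 2) (fun ξ => 1 - (γ (ξ + 1) + γ (ξ - 1)) / 2)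

/-- The atomistic energy `Φ`. -/
def PhiAt (N : ℕ) (φ : ℝ → ℝ) (y : ℤ → ℝ) : ℝ :=
  eps N * ∑ ξ ∈ Finset.Icc (1 : ℤ) (N : ℤ),
    (φ (d1 N y ξ) + φ (d1 N y ξ + d1 N y (ξ + 1)))

/-- The first variation `δΨ(y)[u] = (d/dt)|_{t=0} Ψ(y+tu)`. -/
def fvar (Ψ : (ℤ → ℝ) → ℝ) (y u : ℤ → ℝ) : ℝ :=
  deriv (fun t : ℝ => Ψ (fun ξ => y ξ + t * u ξ)) 0

/-- The second variation `δ²Ψ(y)[u,u] = (d²/dt²)|_{t=0} Ψ(y+tu)`. -/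
def svar (Ψ : (ℤ → ℝ) → ℝ) (y u : ℤ → ℝ) : ℝ :=
  iteratedDeriv 2 (fun t : ℝ => Ψ (fun ξ => y ξ + t * u ξ)) 0

/-- `max_ξ |v_ξ|` (for a periodic sequence this is a genuine maximum). -/
def supAbs (v : ℤ → ℝ) : ℝ := sSup (Set.range fun ξ => |v ξ|)

/-- `min_ξ y'_ξ` (for an admissible deformation this is a genuine minimum). -/
def infD1 (N : ℕ) (y : ℤ → ℝ) : ℝ := sInf (Set.range fun ξ => d1 N y ξ)

/-- The constant `C_i(r₀) = sup_{r ≥ r₀} |φ^(i)(r)|`. -/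
def Cbound (φ : ℝ → ℝ) (i : ℕ) (r₀ : ℝ) : ℝ :=
  sSup ((fun r => |iteratedDeriv i φ r|) '' Set.Ici r₀)

/-- The `ℓ^p_ε` norm over one period, `p ∈ [1,∞]`. -/
def lpnorm (N : ℕ) (p : ℝ≥0∞) (v : ℤ → ℝ) : ℝ :=
  if p = ⊤ then supAbs v
  else (eps N * ∑ ξ ∈ Finset.Icc (1 : ℤ) (N : ℤ), |v ξ| ^ p.toReal) ^ (1 / p.toReal)

/-- The Hessian coefficient `A_ξ` of the atomistic energy. -/
def Acoef (N : ℕ) (φ : ℝ → ℝ) (y : ℤ → ℝ) (ξ : ℤ) : ℝ :=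
  iteratedDeriv 2 φ (d1 N y ξ) + 2 * iteratedDeriv 2 φ (d1 N y ξ + d1 N y (ξ + 1))
    + 2 * iteratedDeriv 2 φ (d1 N y (ξ - 1) + d1 N y ξ)

/-- The Hessian coefficient `Ā_ξ` of the BQC energy. -/
def AbarCoef (N : ℕ) (φ : ℝ → ℝ) (α β : ℤ → ℝ) (y : ℤ → ℝ) (ξ : ℤ) : ℝ :=
  iteratedDeriv 2 φ (d1 N y ξ) + 2 * β ξ * iteratedDeriv 2 φ (d1 N y ξ + d1 N y (ξ + 1))
    + 2 * β (ξ - 1) * iteratedDeriv 2 φ (d1 N y (ξ - 1) + d1 N y ξ)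
    + 4 * α ξ * iteratedDeriv 2 φ (2 * d1 N y ξ)

/-- The coercivity constant `inf { δ²Ψ(y)[u,u] : u ∈ 𝒰, ‖u'‖_{ℓ²_ε} = 1 }`. -/
def coercConst (N : ℕ) (Ψ : (ℤ → ℝ) → ℝ) (y : ℤ → ℝ) : ℝ :=
  sInf { c : ℝ | ∃ u : ℤ → ℝ, inU N u ∧ lpnorm N 2 (d1 N u) = 1 ∧ c = svar Ψ y u }

end

theorem eps_pos {N : ℕ} (hN : 0 < N) : 0 < eps N := by
  unfold eps; positivity

theorem IsPeriodic.sub_one {N : ℕ} {f : ℤ → ℝ} (hf : IsPeriodic N f) :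
    IsPeriodic N fun ξ => f (ξ - 1) := fun ξ => by
  simpa [add_sub_right_comm] using hf (ξ - 1)

theorem IsPeriodic.add_one {N : ℕ} {f : ℤ → ℝ} (hf : IsPeriodic N f) :
    IsPeriodic N fun ξ => f (ξ + 1) := fun ξ => by
  simpa [add_right_comm] using hf (ξ + 1)

/-- A telescoping sum over an integer interval. -/
theorem sum_Icc_add_one_sub (f : ℤ → ℝ) (n : ℕ) :
    ∑ ξ ∈ Icc (1 : ℤ) n, (f (ξ + 1) - f ξ) = f (n + 1) - f 1 := by
  induction n with
  | zero => simp
  | succ n ih =>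
    have h : Icc (1 : ℤ) ((n + 1 : ℕ) : ℤ) = insert ((n : ℤ) + 1) (Icc (1 : ℤ) n) := by
      ext ξ; simp only [mem_Icc, mem_insert]; push_cast; omega
    rw [h, sum_insert (by simp), ih]
    push_cast
    ring

theorem IsPeriodic.sum_add_one {N : ℕ} {f : ℤ → ℝ} (hf : IsPeriodic N f) :
    ∑ ξ ∈ Icc (1 : ℤ) N, f (ξ + 1) = ∑ ξ ∈ Icc (1 : ℤ) N, f ξ := by
  have h := sum_Icc_add_one_sub f N
  rw [sum_sub_distrib, add_comm (N : ℤ) 1, hf 1] at h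
  linarith

theorem IsPeriodic.sum_sub_one {N : ℕ} {f : ℤ → ℝ} (hf : IsPeriodic N f) :
    ∑ ξ ∈ Icc (1 : ℤ) N, f (ξ - 1) = ∑ ξ ∈ Icc (1 : ℤ) N, f ξ := by
  simpa using hf.sub_one.sum_add_one.symm

theorem IsPeriodic.exists_mem_Icc {N : ℕ} (hN : 0 < N) {f : ℤ → ℝ} (hf : IsPeriodic N f)
    (ξ : ℤ) : ∃ η ∈ Icc (1 : ℤ) N, f ξ = f η := by
  have hN' : (0 : ℤ) < N := by exact_mod_cast hN
  have hper : Function.Periodic f (N : ℤ) := hf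
  refine ⟨(ξ - 1) % N + 1, ?_, ?_⟩
  · have h₀ := Int.emod_nonneg (ξ - 1) hN'.ne'
    have h₁ := Int.emod_lt_of_pos (ξ - 1) hN'
    rw [mem_Icc]; omega
  · have h := hper.int_mul ((ξ - 1) / N) ((ξ - 1) % N + 1)
    rw [← h]
    congr 1
    have := Int.emod_add_mul_ediv (ξ - 1) N
    simp only [Int.cast_id]
    linarith

theorem IsPeriodic.bddAbove_range_abs {N : ℕ} (hN : 0 < N) {f : ℤ → ℝ} (hf : IsPeriodic N f) :
    BddAbove (Set.range fun ξ => |f ξ|) := by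
  refine ((Icc (1 : ℤ) N).finite_toSet.image fun ξ => |f ξ|).bddAbove.mono ?_
  rintro _ ⟨ξ, rfl⟩
  obtain ⟨η, hη, h⟩ := hf.exists_mem_Icc hN ξ
  exact ⟨η, hη, by simp [h]⟩

theorem lpnorm_sub_one {N : ℕ} (p : ℝ≥0∞) {f : ℤ → ℝ} (hf : IsPeriodic N f) :
    lpnorm N p (fun ξ => f (ξ - 1)) = lpnorm N p f := by
  unfold lpnorm supAbs
  split_ifs
  · congr 1
    exact (Equiv.subRight (1 : ℤ)).surjective.range_comp fun ξ => |f ξ|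
  · have h : IsPeriodic N fun ξ => |f ξ| ^ p.toReal := fun ξ => by simp only [hf ξ]
    rw [h.sum_sub_one]

theorem lpnorm_nonneg (N : ℕ) (p : ℝ≥0∞) (f : ℤ → ℝ) : 0 ≤ lpnorm N p f := by
  unfold lpnorm supAbs
  split_ifs
  · exact Real.sSup_nonneg (by rintro _ ⟨ξ, rfl⟩; positivity)
  · unfold eps; positivity

theorem lpnorm_one (N : ℕ) (f : ℤ → ℝ) :
    lpnorm N 1 f = eps N * ∑ ξ ∈ Icc (1 : ℤ) N, |f ξ| := by
  simp [lpnorm]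

theorem sum_mul_abs_le_supAbs_mul {N : ℕ} (hN : 0 < N) {f : ℤ → ℝ} (hf : IsPeriodic N f)
    (g : ℤ → ℝ) :
    eps N * ∑ ξ ∈ Icc (1 : ℤ) N, |f ξ| * |g ξ| ≤ lpnorm N ⊤ f * lpnorm N 1 g := by
  rw [lpnorm_one, mul_left_comm, mul_sum _ _ (lpnorm N ⊤ f)]
  refine mul_le_mul_of_nonneg_left (sum_le_sum fun ξ _ => ?_) (eps_pos hN).le
  refine mul_le_mul_of_nonneg_right ?_ (abs_nonneg _)
  simp only [lpnorm, if_true, supAbs]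
  exact le_csSup (hf.bddAbove_range_abs hN) ⟨ξ, rfl⟩

/-- Hölder's inequality for the `ℓ^p_ε` norms. -/
theorem sum_mul_abs_le_lpnorm_mul {N : ℕ} (hN : 0 < N) {p q : ℝ≥0∞} (hpq : 1 / p + 1 / q = 1)
    {f g : ℤ → ℝ} (hf : IsPeriodic N f) (hg : IsPeriodic N g) :
    eps N * ∑ ξ ∈ Icc (1 : ℤ) N, |f ξ| * |g ξ| ≤ lpnorm N p f * lpnorm N q g := by
  have hε := eps_pos hN
  by_cases hp : p = ⊤
  · have hq : q = 1 := by simpa [hp] using hpq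
    rw [hp, hq]
    exact sum_mul_abs_le_supAbs_mul hN hf g
  by_cases hq : q = ⊤
  · have hp : p = 1 := by simpa [hq] using hpq
    rw [hp, hq, mul_comm (lpnorm N 1 f)]
    simpa only [mul_comm] using sum_mul_abs_le_supAbs_mul hN hg f
  have : ENNReal.HolderConjugate p q := ⟨by simpa using hpq⟩
  have hc := ENNReal.HolderConjugate.toReal_of_ne_top hp hq
  have key := Real.inner_le_Lp_mul_Lq (Icc (1 : ℤ) N) (fun ξ => |f ξ|) (fun ξ => |g ξ|) hc
  simp only [abs_abs] at key
  simp only [lpnorm, if_neg hp, if_neg hq]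
  rw [Real.mul_rpow hε.le (by positivity), Real.mul_rpow hε.le (by positivity),
    mul_mul_mul_comm, ← Real.rpow_add hε, one_div, one_div, hc.inv_add_inv_eq_one, Real.rpow_one]
  simp only [one_div] at key
  exact mul_le_mul_of_nonneg_left key hε.le

theorem d1_add_mul (N : ℕ) (y u : ℤ → ℝ) (t : ℝ) (ξ : ℤ) :
    d1 N (fun ξ => y ξ + t * u ξ) ξ = d1 N y ξ + t * d1 N u ξ := by
  unfold d1; ring

theorem isPeriodic_d1 {N : ℕ} {u : ℤ → ℝ} (hu : IsPeriodic N u) : IsPeriodic N (d1 N u) :=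
  fun ξ => by simp only [d1, hu ξ, add_sub_right_comm ξ, hu (ξ - 1)]

theorem isPeriodic_d1_of_inY {N : ℕ} {y : ℤ → ℝ} (hy : inY N y) : IsPeriodic N (d1 N y) := by
  obtain ⟨F, -, u, ⟨hu, -⟩, rfl⟩ := hy
  intro ξ
  simp only [d1, yUnif, hu ξ, add_sub_right_comm ξ, hu (ξ - 1)]
  push_cast
  ring

theorem d1_add_one {N : ℕ} (hN : 0 < N) (y : ℤ → ℝ) (ξ : ℤ) :
    d1 N y (ξ + 1) = d1 N y ξ + eps N * d2 N y ξ := by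
  have := (eps_pos hN).ne'
  simp only [d1, d2, add_sub_cancel_right]
  field_simp
  ring

theorem d1_sub_one {N : ℕ} (hN : 0 < N) (y : ℤ → ℝ) (ξ : ℤ) :
    d1 N y (ξ - 1) = d1 N y ξ - eps N * d2 N y (ξ - 1) := by
  have h := d1_add_one hN y (ξ - 1)
  rw [sub_add_cancel] at h
  linarith

theorem d2_sub_one {N : ℕ} (hN : 0 < N) (y : ℤ → ℝ) (ξ : ℤ) :
    d2 N y (ξ - 1) = d2 N y ξ - eps N * d3 N y ξ := by
  have := (eps_pos hN).ne'
  have h : ξ - 1 - 1 = ξ - 2 := by ring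
  simp only [d2, d3, sub_add_cancel, h]
  field_simp
  ring

theorem isPeriodic_d2_of_inY {N : ℕ} (hN : 0 < N) {y : ℤ → ℝ} (hy : inY N y) :
    IsPeriodic N (d2 N y) := fun ξ => by
  have ha := isPeriodic_d1_of_inY hy
  have h₁ := d1_add_one hN y ξ
  have h₂ := d1_add_one hN y (ξ + N)
  rw [show d1 N y (ξ + N + 1) = d1 N y (ξ + 1) from ha.add_one ξ, ha ξ, h₁] at h₂
  exact (mul_left_cancel₀ (eps_pos hN).ne' (add_left_cancel h₂)).symm

theorem isPeriodic_d3_of_inY {N : ℕ} (hN : 0 < N) {y : ℤ → ℝ} (hy : inY N y) :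
    IsPeriodic N (d3 N y) := fun ξ => by
  have hb := isPeriodic_d2_of_inY hN hy
  have h₁ := d2_sub_one hN y ξ
  have h₂ := d2_sub_one hN y (ξ + N)
  rw [show d2 N y (ξ + N - 1) = d2 N y (ξ - 1) from hb.sub_one ξ, hb ξ, h₁] at h₂
  exact (mul_left_cancel₀ (eps_pos hN).ne' (sub_right_injective h₂)).symm

theorem infD1_le {N : ℕ} {y : ℤ → ℝ} (hy : 0 < infD1 N y) (ξ : ℤ) : infD1 N y ≤ d1 N y ξ := by
  refine csInf_le ?_ ⟨ξ, rfl⟩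
  by_contra h
  exact hy.ne' (Real.sInf_of_not_bddBelow h)

theorem hasDerivAt_iteratedDeriv {φ : ℝ → ℝ} {n : ℕ} (hφ : ContDiffOn ℝ n φ (Set.Ioi 0))
    {i : ℕ} (hi : i < n) {x : ℝ} (hx : 0 < x) :
    HasDerivAt (iteratedDeriv i φ) (iteratedDeriv (i + 1) φ x) x := by
  have h := hφ.differentiableOn_iteratedDerivWithin (m := i) (by exact_mod_cast hi)
    isOpen_Ioi.uniqueDiffOn
  have h' := (h.congr fun z hz => (iteratedDerivWithin_of_isOpen isOpen_Ioi hz).symm).differentiableAt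
    (Ioi_mem_nhds hx)
  rw [iteratedDeriv_succ]
  exact h'.hasDerivAt

theorem abs_iteratedDeriv_le_Cbound {φ : ℝ → ℝ} {i : ℕ} {r₀ : ℝ}
    (hC : BddAbove ((fun r => |iteratedDeriv i φ r|) '' Set.Ici r₀)) {r : ℝ} (hr : r₀ ≤ r) :
    |iteratedDeriv i φ r| ≤ Cbound φ i r₀ :=
  le_csSup hC ⟨r, hr, rfl⟩

/-- First-order Taylor estimate on a half-line. -/
theorem abs_sub_sub_mul_le_of_abs_deriv_le {f f' f'' : ℝ → ℝ} {r₀ C : ℝ}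
    (hf : ∀ x, r₀ ≤ x → HasDerivAt f (f' x) x) (hf' : ∀ x, r₀ ≤ x → HasDerivAt f' (f'' x) x)
    (hC : ∀ x, r₀ ≤ x → |f'' x| ≤ C) {r h : ℝ} (hr : r₀ ≤ r) (hrh : r₀ ≤ r + h) :
    |f (r + h) - f r - f' r * h| ≤ C / 2 * h ^ 2 := by
  have hmem : ∀ t ∈ Set.Icc (0 : ℝ) 1, r₀ ≤ r + t * h := fun t ht => by
    nlinarith [ht.1, ht.2]
  have hlin : ∀ t : ℝ, HasDerivAt (fun t => r + t * h) h t := fun t => by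
    simpa using ((hasDerivAt_id t).mul_const h).const_add r
  have hg : ∀ t ∈ Set.Icc (0 : ℝ) 1, HasDerivAt (fun t => f (r + t * h) - f r - f' r * (t * h))
      (f' (r + t * h) * h - f' r * h) t := fun t ht => by
    have h₁ := (hf _ (hmem t ht)).comp t (hlin t)
    have h₂ := ((hasDerivAt_id t).mul_const h).const_mul (f' r)
    exact ((h₁.sub_const (f r)).sub h₂).congr_deriv (by simp)
  have hB : ∀ t : ℝ, HasDerivAt (fun t => C / 2 * h ^ 2 * t ^ 2) (C * h ^ 2 * t) t := fun t => by
    have := ((hasDerivAt_id t).pow 2).const_mul (C / 2 * h ^ 2)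
    refine this.congr_deriv ?_
    simp; ring
  have key := image_norm_le_of_norm_deriv_right_le_deriv_boundary
    (fun t ht => (hg t ht).continuousAt.continuousWithinAt)
    (fun t ht => (hg t ⟨ht.1, ht.2.le⟩).hasDerivWithinAt) (by simp) hB
    (fun t ht => ?_) (Set.right_mem_Icc.2 zero_le_one)
  · simpa using key
  · have hmv := (convex_Ici r₀).norm_image_sub_le_of_norm_hasDerivWithin_le
      (fun x hx => (hf' x hx).hasDerivWithinAt) (fun x hx => hC x hx) hr
      (hmem t ⟨ht.1, ht.2.le⟩)
    rw [Real.norm_eq_abs, Real.norm_eq_abs, add_sub_cancel_left, abs_mul, abs_of_nonneg ht.1] at hmv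
    rw [← sub_mul, Real.norm_eq_abs, abs_mul, ← sq_abs h]
    nlinarith [abs_nonneg h]

theorem fvar_PhiBQC {N : ℕ} {φ φ' : ℝ → ℝ} (hφ : ∀ x, 0 < x → HasDerivAt φ (φ' x) x)
    (α β : ℤ → ℝ) {y : ℤ → ℝ} (hy : ∀ ξ, 0 < d1 N y ξ) (u : ℤ → ℝ) :
    fvar (PhiBQC N φ α β) y u = eps N * ∑ ξ ∈ Icc (1 : ℤ) N,
      (φ' (d1 N y ξ) * d1 N u ξ + α ξ * (φ' (2 * d1 N y ξ) * (2 * d1 N u ξ))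
        + β ξ * (φ' (d1 N y ξ + d1 N y (ξ + 1)) * (d1 N u ξ + d1 N u (ξ + 1)))) := by
  have hlin : ∀ ξ, HasDerivAt (fun t : ℝ => d1 N y ξ + t * d1 N u ξ) (d1 N u ξ) 0 := fun ξ => by
    simpa using ((hasDerivAt_id (0 : ℝ)).mul_const (d1 N u ξ)).const_add (d1 N y ξ)
  have hcomp : ∀ {g : ℝ → ℝ} {b x : ℝ}, HasDerivAt g b 0 → g 0 = x → 0 < x →
      HasDerivAt (fun t => φ (g t)) (φ' x * b) 0 := fun {g b x} hg h0 hx => by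
    subst h0
    exact (hφ _ hx).comp 0 hg
  unfold fvar PhiBQC
  simp only [d1_add_mul]
  refine HasDerivAt.deriv ?_
  refine HasDerivAt.const_mul _ (HasDerivAt.fun_sum fun ξ _ => ?_)
  refine ((hcomp (hlin ξ) (by simp) (hy ξ)).add ((hcomp ((hlin ξ).const_mul 2) (by simp)
    (mul_pos two_pos (hy ξ))).const_mul _)).add ((hcomp ((hlin ξ).add (hlin (ξ + 1))) (by simp)
    (add_pos (hy ξ) (hy (ξ + 1)))).const_mul _)

theorem PhiAt_eq_PhiBQC (N : ℕ) (φ : ℝ → ℝ) :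
    PhiAt N φ = PhiBQC N φ (fun _ => 0) (fun _ => 1) := by
  funext y
  simp [PhiAt, PhiBQC]

/-- The difference of the atomistic and blended stresses at the bond `ξ`. -/
noncomputable def stressError (N : ℕ) (φ : ℝ → ℝ) (α β : ℤ → ℝ) (y : ℤ → ℝ) (ξ : ℤ) : ℝ :=
  (1 - β ξ) * iteratedDeriv 1 φ (d1 N y ξ + d1 N y (ξ + 1))
    + (1 - β (ξ - 1)) * iteratedDeriv 1 φ (d1 N y (ξ - 1) + d1 N y ξ)
    - 2 * α ξ * iteratedDeriv 1 φ (2 * d1 N y ξ)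

theorem fvar_PhiAt_sub_fvar_PhiBQC {N : ℕ} {φ : ℝ → ℝ}
    (hφ : ∀ x, 0 < x → HasDerivAt φ (iteratedDeriv 1 φ x) x) {α β y u : ℤ → ℝ}
    (hβ : IsPeriodic N β) (hyper : IsPeriodic N (d1 N y)) (hy : ∀ ξ, 0 < d1 N y ξ)
    (hu : IsPeriodic N u) :
    fvar (PhiAt N φ) y u - fvar (PhiBQC N φ α β) y u
      = eps N * ∑ ξ ∈ Icc (1 : ℤ) N, stressError N φ α β y ξ * d1 N u ξ := by
  rw [PhiAt_eq_PhiBQC, fvar_PhiBQC hφ _ _ hy, fvar_PhiBQC hφ _ _ hy, ← mul_sub,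
    ← sum_sub_distrib]
  congr 1
  have hv := isPeriodic_d1 hu
  set g : ℤ → ℝ := fun ξ =>
    (1 - β (ξ - 1)) * iteratedDeriv 1 φ (d1 N y (ξ - 1) + d1 N y ξ) * d1 N u ξ with hg
  have hper : IsPeriodic N g := fun ξ => by
    have h₁ := hβ.sub_one ξ
    have h₂ := hyper.sub_one ξ
    simp only at h₁ h₂
    simp only [hg, h₁, h₂, hyper ξ, hv ξ]
  rw [← sub_eq_zero, ← sum_sub_distrib]
  refine Eq.trans ?_ (sub_eq_zero.2 hper.sum_add_one)
  rw [← sum_sub_distrib]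
  refine sum_congr rfl fun ξ _ => ?_
  simp only [hg, stressError, add_sub_cancel_right]
  ring

theorem abs_stressError_le {N : ℕ} (hN : 0 < N) {φ : ℝ → ℝ} (hφ : ContDiffOn ℝ 4 φ (Set.Ioi 0))
    {α β y : ℤ → ℝ} (hβ : ∀ ξ, β ξ ≤ 1)
    (hαβ : ∀ ξ, (1 - β ξ) + (1 - β (ξ - 1)) = α (ξ + 1) + α (ξ - 1))
    {r : ℝ} (hr : 0 < r) (hy : ∀ ξ, r ≤ d1 N y ξ) {C₁ C₂ C₃ : ℝ}
    (hC₁ : ∀ x, 2 * r ≤ x → |iteratedDeriv 1 φ x| ≤ C₁)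
    (hC₂ : ∀ x, 2 * r ≤ x → |iteratedDeriv 2 φ x| ≤ C₂)
    (hC₃ : ∀ x, 2 * r ≤ x → |iteratedDeriv 3 φ x| ≤ C₃) (ξ : ℤ) :
    |stressError N φ α β y ξ| ≤ C₁ * |α (ξ + 1) - 2 * α ξ + α (ξ - 1)|
      + eps N * C₂ * |(β ξ - β (ξ - 1)) * d2 N y ξ|
      + eps N ^ 2 * C₂ * |(1 - β (ξ - 1)) * d3 N y ξ|
      + eps N ^ 2 * (C₃ / 2) * |(1 - β ξ) * d2 N y ξ ^ 2|
      + eps N ^ 2 * (C₃ / 2) * |(1 - β (ξ - 1)) * d2 N y (ξ - 1) ^ 2| := by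
  have hε := eps_pos hN
  have hD : ∀ i < 4, ∀ x, 2 * r ≤ x →
      HasDerivAt (iteratedDeriv i φ) (iteratedDeriv (i + 1) φ x) x := fun i hi x hx =>
    hasDerivAt_iteratedDeriv (n := 4) (by exact_mod_cast hφ) hi (by linarith)
  have hp := d1_add_one hN y ξ
  have hm := d1_sub_one hN y ξ
  have ha := hy ξ
  have hap := hy (ξ + 1)
  have ham := hy (ξ - 1)
  have ep : d1 N y ξ + d1 N y (ξ + 1) = 2 * d1 N y ξ + eps N * d2 N y ξ := by linarith
  have em : d1 N y (ξ - 1) + d1 N y ξ = 2 * d1 N y ξ + -(eps N * d2 N y (ξ - 1)) := by linarith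
  have tp := abs_sub_sub_mul_le_of_abs_deriv_le (hD 1 (by norm_num)) (hD 2 (by norm_num)) hC₃
    (r := 2 * d1 N y ξ) (h := eps N * d2 N y ξ) (by linarith) (by linarith)
  have tm := abs_sub_sub_mul_le_of_abs_deriv_le (hD 1 (by norm_num)) (hD 2 (by norm_num)) hC₃
    (r := 2 * d1 N y ξ) (h := -(eps N * d2 N y (ξ - 1))) (by linarith) (by linarith)
  have h2 := d2_sub_one hN y ξ
  have hb := hβ ξ
  have hb' := hβ (ξ - 1)
  have c₁ := hC₁ (2 * d1 N y ξ) (by linarith)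
  have c₂ := hC₂ (2 * d1 N y ξ) (by linarith)
  have hs := hαβ ξ
  rw [← ep] at tp
  rw [← em] at tm
  unfold stressError
  simp only [Nat.reduceAdd] at tp tm
  set f₀ := iteratedDeriv 1 φ (2 * d1 N y ξ)
  set f₁ := iteratedDeriv 1 φ (d1 N y ξ + d1 N y (ξ + 1))
  set f₂ := iteratedDeriv 1 φ (d1 N y (ξ - 1) + d1 N y ξ)
  set s := iteratedDeriv 2 φ (2 * d1 N y ξ)
  have split : (1 - β ξ) * f₁ + (1 - β (ξ - 1)) * f₂ - 2 * α ξ * f₀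
      = f₀ * (α (ξ + 1) - 2 * α ξ + α (ξ - 1))
        + -(eps N * s * ((β ξ - β (ξ - 1)) * d2 N y ξ))
        + eps N ^ 2 * s * ((1 - β (ξ - 1)) * d3 N y ξ)
        + (1 - β ξ) * (f₁ - f₀ - s * (eps N * d2 N y ξ))
        + (1 - β (ξ - 1)) * (f₂ - f₀ - s * -(eps N * d2 N y (ξ - 1))) := by
    linear_combination f₀ * hs - eps N * s * (1 - β (ξ - 1)) * h2
  rw [split]
  refine (abs_add_le _ _).trans (add_le_add ((abs_add_le _ _).trans (add_le_add
    ((abs_add_le _ _).trans (add_le_add ((abs_add_le _ _).trans (add_le_add ?_ ?_)) ?_)) ?_)) ?_)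
  · rw [abs_mul]; gcongr
  · rw [abs_neg, abs_mul, abs_mul (eps N), abs_of_pos hε]; gcongr
  · rw [abs_mul, abs_mul (eps N ^ 2), abs_of_pos (pow_pos hε 2)]; gcongr
  · rw [abs_mul, abs_of_nonneg (sub_nonneg.2 hb), abs_of_nonneg
      (mul_nonneg (sub_nonneg.2 hb) (sq_nonneg _))]
    calc _ ≤ _ := mul_le_mul_of_nonneg_left tp (sub_nonneg.2 hb)
      _ = _ := by ring
  · rw [abs_mul, abs_of_nonneg (sub_nonneg.2 hb'), abs_of_nonneg
      (mul_nonneg (sub_nonneg.2 hb') (sq_nonneg _))]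
    calc _ ≤ _ := mul_le_mul_of_nonneg_left tm (sub_nonneg.2 hb')
      _ = _ := by ring

/-- Modeling error of BQCE in the dual norm. -/
theorem modeling_error_bqce
    (N : ℕ) (hN : 5 ≤ N) (φ : ℝ → ℝ) (hφ : ContDiffOn ℝ 4 φ (Set.Ioi 0))
    (hC : ∀ i ≤ 4, ∀ r₀ : ℝ, 0 < r₀ →
      BddAbove ((fun r => |iteratedDeriv i φ r|) '' Set.Ici r₀))
    (γ : ℤ → ℝ) (hγper : IsPeriodic N γ) (hγ01 : ∀ ξ, γ ξ ∈ Set.Icc (0 : ℝ) 1)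
    (α β : ℤ → ℝ) (hα : α = fun ξ => (γ ξ + γ (ξ - 1)) / 2)
    (hβ : β = fun ξ => 1 - (γ (ξ + 1) + γ (ξ - 1)) / 2)
    (y : ℤ → ℝ) (hy : inY N y) (hy' : 0 < infD1 N y)
    (p q : ℝ≥0∞) (hp : 1 ≤ p) (hq : 1 ≤ q) (hpq : 1 / p + 1 / q = 1)
    (u : ℤ → ℝ) (hu : inU N u) (hu1 : lpnorm N q (d1 N u) ≤ 1) :
    |fvar (PhiAt N φ) y u - fvar (PhiBQCE N φ γ) y u| ≤
      Cbound φ 1 (2 * infD1 N y) *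
          lpnorm N p (fun ξ => α (ξ + 1) - 2 * α ξ + α (ξ - 1))
        + eps N * Cbound φ 2 (2 * infD1 N y) *
            lpnorm N p (fun ξ => (β ξ - β (ξ - 1)) * d2 N y ξ)
        + (eps N) ^ 2 *
            (Cbound φ 2 (2 * infD1 N y) * lpnorm N p (fun ξ => (1 - β (ξ - 1)) * d3 N y ξ)
              + Cbound φ 3 (2 * infD1 N y) *
                  lpnorm N p (fun ξ => (1 - β ξ) * (d2 N y ξ) ^ 2)) := by
  have hN₀ : 0 < N := by omega
  have hε := eps_pos hN₀
  have hr : 0 < 2 * infD1 N y := by linarith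
  have hbound : ∀ i ≤ 4, ∀ x, 2 * infD1 N y ≤ x →
      |iteratedDeriv i φ x| ≤ Cbound φ i (2 * infD1 N y) := fun i hi x hx =>
    abs_iteratedDeriv_le_Cbound (hC i hi _ hr) hx
  have hCnn : ∀ i ≤ 4, 0 ≤ Cbound φ i (2 * infD1 N y) := fun i hi =>
    (abs_nonneg _).trans (hbound i hi _ le_rfl)
  have hαper : IsPeriodic N α := fun ξ => by
    have h := hγper.sub_one ξ
    simp only at h
    simp only [hα, hγper ξ, h]
  have hβper : IsPeriodic N β := fun ξ => by
    have h := hγper.sub_one ξ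
    have h' := hγper.add_one ξ
    simp only at h h'
    simp only [hβ, h, h']
  have hβ1 : ∀ ξ, β ξ ≤ 1 := fun ξ => by
    simp only [hβ]
    linarith [(hγ01 (ξ + 1)).1, (hγ01 (ξ - 1)).1]
  have hαβ : ∀ ξ, (1 - β ξ) + (1 - β (ξ - 1)) = α (ξ + 1) + α (ξ - 1) := fun ξ => by
    simp only [hα, hβ, sub_add_cancel, add_sub_cancel_right]
    ring
  have hle := infD1_le hy'
  have hφ' : ∀ x, 0 < x → HasDerivAt φ (iteratedDeriv 1 φ x) x := fun x hx => by
    simpa using hasDerivAt_iteratedDeriv (n := 4) (i := 0) (by exact_mod_cast hφ) (by norm_num) hx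
  have hstress := abs_stressError_le hN₀ hφ hβ1 hαβ hy' hle (hbound 1 (by norm_num))
    (hbound 2 (by norm_num)) (hbound 3 (by norm_num))
  have hPhi : PhiBQCE N φ γ = PhiBQC N φ α β := by rw [hα, hβ, PhiBQCE]
  rw [hPhi, fvar_PhiAt_sub_fvar_PhiBQC hφ' hβper (isPeriodic_d1_of_inY hy)
    (fun ξ => hy'.trans_le (hle ξ)) hu.1]
  have holder : ∀ {f : ℤ → ℝ}, IsPeriodic N f →
      eps N * ∑ ξ ∈ Icc (1 : ℤ) N, |f ξ| * |d1 N u ξ| ≤ lpnorm N p f := fun {f} hf =>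
    (sum_mul_abs_le_lpnorm_mul hN₀ hpq hf (isPeriodic_d1 hu.1)).trans
      (mul_le_of_le_one_right (lpnorm_nonneg N p f) hu1)
  have hd2 := isPeriodic_d2_of_inY hN₀ hy
  have hA : IsPeriodic N fun ξ => α (ξ + 1) - 2 * α ξ + α (ξ - 1) := fun ξ => by
    have h := hαper.sub_one ξ
    have h' := hαper.add_one ξ
    simp only at h h'
    simp only [h, h', hαper ξ]
  have hβper' : ∀ ξ : ℤ, β (ξ + N - 1) = β (ξ - 1) := hβper.sub_one
  have hB : IsPeriodic N fun ξ => (β ξ - β (ξ - 1)) * d2 N y ξ := fun ξ => by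
    simp only [hβper ξ, hβper' ξ, hd2 ξ]
  have hD : IsPeriodic N fun ξ => (1 - β (ξ - 1)) * d3 N y ξ := fun ξ => by
    simp only [hβper' ξ, isPeriodic_d3_of_inY hN₀ hy ξ]
  have hE : IsPeriodic N fun ξ => (1 - β ξ) * d2 N y ξ ^ 2 := fun ξ => by
    simp only [hβper ξ, hd2 ξ]
  have iA := holder hA
  have iB := holder hB
  have iD := holder hD
  have iE := holder hE
  have iE' := holder hE.sub_one
  rw [lpnorm_sub_one p hE] at iE'
  have c₁ := hCnn 1 (by norm_num)
  have c₂ := hCnn 2 (by norm_num)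
  have c₃ := hCnn 3 (by norm_num)
  set C₁ := Cbound φ 1 (2 * infD1 N y)
  set C₂ := Cbound φ 2 (2 * infD1 N y)
  set C₃ := Cbound φ 3 (2 * infD1 N y)
  calc |eps N * ∑ ξ ∈ Icc (1 : ℤ) N, stressError N φ α β y ξ * d1 N u ξ|
      ≤ eps N * ∑ ξ ∈ Icc (1 : ℤ) N, |stressError N φ α β y ξ| * |d1 N u ξ| := by
        rw [abs_mul, abs_of_pos hε]
        refine mul_le_mul_of_nonneg_left ((abs_sum_le_sum_abs _ _).trans_eq ?_) hε.le
        simp only [abs_mul]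
    _ ≤ eps N * ∑ ξ ∈ Icc (1 : ℤ) N, _ * |d1 N u ξ| :=
        mul_le_mul_of_nonneg_left (sum_le_sum fun ξ _ =>
          mul_le_mul_of_nonneg_right (hstress ξ) (abs_nonneg _)) hε.le
    _ = C₁ * (eps N * ∑ ξ ∈ Icc (1 : ℤ) N, |α (ξ + 1) - 2 * α ξ + α (ξ - 1)| * |d1 N u ξ|)
        + eps N * C₂ * (eps N * ∑ ξ ∈ Icc (1 : ℤ) N,
            |(β ξ - β (ξ - 1)) * d2 N y ξ| * |d1 N u ξ|)
        + eps N ^ 2 * C₂ * (eps N * ∑ ξ ∈ Icc (1 : ℤ) N,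
            |(1 - β (ξ - 1)) * d3 N y ξ| * |d1 N u ξ|)
        + eps N ^ 2 * (C₃ / 2) * (eps N * ∑ ξ ∈ Icc (1 : ℤ) N,
            |(1 - β ξ) * d2 N y ξ ^ 2| * |d1 N u ξ|)
        + eps N ^ 2 * (C₃ / 2) * (eps N * ∑ ξ ∈ Icc (1 : ℤ) N,
            |(1 - β (ξ - 1)) * d2 N y (ξ - 1) ^ 2| * |d1 N u ξ|) := by
        simp only [mul_sum, ← sum_add_distrib]
        exact sum_congr rfl fun ξ _ => by ring
    _ ≤ C₁ * lpnorm N p (fun ξ => α (ξ + 1) - 2 * α ξ + α (ξ - 1))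
        + eps N * C₂ * lpnorm N p (fun ξ => (β ξ - β (ξ - 1)) * d2 N y ξ)
        + eps N ^ 2 * C₂ * lpnorm N p (fun ξ => (1 - β (ξ - 1)) * d3 N y ξ)
        + eps N ^ 2 * (C₃ / 2) * lpnorm N p (fun ξ => (1 - β ξ) * d2 N y ξ ^ 2)
        + eps N ^ 2 * (C₃ / 2) * lpnorm N p (fun ξ => (1 - β ξ) * d2 N y ξ ^ 2) := by
        gcongr
    _ = _ := by ring
end

section
/- (Decay of the ghost force with blending width, p < ∞.) Let k ≥ 1 be an integer, let γ_s : ℝ → [0,1] be twice continuously differentiable with γ_s(x) = 0 for all x ≤ 0 and γ_s(x) = 1 for all x ≥ 1, let i ∈ ℤ, and define γ_J(ξ) := γ_s((ξ − i)/k) for ξ ∈ ℤ. Then for every p ∈ [1,∞), ( ε Σ_{ξ=i}^{i+k} |Δ²γ_J(ξ)|^p )^{1/p} ≤ ε^{1/p} k^{1/p − 2} ( ∫₀¹ |γ_s''(s)|^p ds )^{1/p}. -/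
open scoped BigOperators

/-- Jensen's inequality for the increment of a `C¹` function over a unit interval. -/
theorem abs_sub_rpow_le_integral {F F' : ℝ → ℝ} (hF : ∀ x, HasDerivAt F (F' x) x)
    (hF' : Continuous F') {p : ℝ} (hp : 1 ≤ p) (a : ℝ) :
    |F (a + 1) - F a| ^ p ≤ ∫ x in a..a + 1, |F' x| ^ p := by
  have hab : a ≤ a + 1 := by linarith
  have hpow : Continuous fun x => |F' x| ^ p :=
    hF'.abs.rpow_const fun _ => Or.inr (by linarith)
  have hprob : MeasureTheory.IsProbabilityMeasure
      (MeasureTheory.volume.restrict (Set.Ioc a (a + 1))) := ⟨by simp⟩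
  rw [← intervalIntegral.integral_eq_sub_of_hasDerivAt (fun x _ => hF x)
    (hF'.intervalIntegrable _ _)]
  calc |∫ x in a..a + 1, F' x| ^ p ≤ (∫ x in a..a + 1, |F' x|) ^ p := by
        gcongr
        exact intervalIntegral.abs_integral_le_integral_abs hab
    _ ≤ ∫ x in a..a + 1, |F' x| ^ p := by
        rw [intervalIntegral.integral_of_le hab, intervalIntegral.integral_of_le hab]
        exact (convexOn_rpow hp).map_integral_le
          (continuousOn_id.rpow_const fun _ _ => Or.inr (by linarith)) isClosed_Ici
          (Filter.Eventually.of_forall fun x => abs_nonneg (F' x))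
          ((intervalIntegrable_iff_integrableOn_Ioc_of_le hab).1
            (hF'.abs.intervalIntegrable _ _))
          ((intervalIntegrable_iff_integrableOn_Ioc_of_le hab).1
            (hpow.intervalIntegrable _ _))

/-- The `ℓᵖ` norm of the second differences of a `C²` function whose second derivative lives on
`[0, k]` is controlled by the `Lᵖ` norm of that second derivative. -/
theorem sum_abs_second_difference_rpow_le {f f' f'' : ℝ → ℝ} (hf : ∀ x, HasDerivAt f (f' x) x)
    (hf' : ∀ x, HasDerivAt f' (f'' x) x) (hf'' : Continuous f'') {k : ℕ}
    (hleft : ∀ x ≤ 0, f'' x = 0) (hright : ∀ x, (k : ℝ) ≤ x → f'' x = 0)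
    {p : ℝ} (hp : 1 ≤ p) :
    ∑ j ∈ Finset.range (k + 1), |f (j + 1) - 2 * f j + f (j - 1)| ^ p ≤
      ∫ x in (0 : ℝ)..k, |f'' x| ^ p := by
  have hp0 : p ≠ 0 := by linarith
  have hpow : Continuous fun x => |f'' x| ^ p :=
    hf''.abs.rpow_const fun _ => Or.inr (by linarith)
  have hint : ∀ a b, IntervalIntegrable (fun x => |f'' x| ^ p) MeasureTheory.volume a b :=
    fun a b => hpow.intervalIntegrable a b
  set P : ℝ → ℝ := fun u => ∫ x in (0 : ℝ)..u, |f'' x| ^ p with hP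
  have hPc : Continuous P := intervalIntegral.continuous_primitive hint 0
  have hPleft : ∀ u ≤ 0, P u = 0 := by
    intro u hu
    rw [hP]
    refine intervalIntegral.integral_zero_ae (Filter.Eventually.of_forall fun x hx => ?_)
    rw [Set.uIoc_of_ge hu] at hx
    simp [hleft x hx.2, hp0]
  have hPright : ∀ u, (k : ℝ) ≤ u → P u = P k := by
    intro u hu
    rw [← sub_eq_zero, hP]
    simp only
    rw [intervalIntegral.integral_interval_sub_left (hint _ _) (hint _ _)]
    refine intervalIntegral.integral_zero_ae (Filter.Eventually.of_forall fun x hx => ?_)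
    rw [Set.uIoc_of_le hu] at hx
    simp [hright x hx.1.le, hp0]
  have hf'c : Continuous f' := continuous_iff_continuousAt.2 fun x => (hf' x).continuousAt
  have hshift : Continuous fun u => f' u - f' (u - 1) := by fun_prop
  have hPi : ∀ a b, IntervalIntegrable P MeasureTheory.volume a b :=
    fun a b => hPc.intervalIntegrable a b
  have hterm : ∀ j : ℕ, |f (j + 1) - 2 * f j + f (j - 1)| ^ p ≤
      (∫ u in ((j + 1 : ℕ) : ℝ) - 1..((j + 1 : ℕ) : ℝ), P u) -
        ∫ u in (j : ℝ) - 1..(j : ℝ), P u := by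
    intro j
    have hF : ∀ u, HasDerivAt (fun u => f u - f (u - 1)) (f' u - f' (u - 1)) u :=
      fun u => (hf u).sub ((hf (u - 1)).comp_sub_const u 1)
    calc |f (j + 1) - 2 * f j + f (j - 1)| ^ p
        = |(f (j + 1) - f (j + 1 - 1)) - (f j - f (j - 1))| ^ p := by
          rw [add_sub_cancel_right]; congr 2; ring
      _ ≤ ∫ u in (j : ℝ)..j + 1, |f' u - f' (u - 1)| ^ p :=
          abs_sub_rpow_le_integral hF hshift hp j
      _ ≤ ∫ u in (j : ℝ)..j + 1, (P u - P (u - 1)) := by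
          refine intervalIntegral.integral_mono_on (by linarith)
            ((hshift.abs.rpow_const fun _ => Or.inr (by linarith)).intervalIntegrable _ _)
            (Continuous.intervalIntegrable (by fun_prop) _ _) fun u _ => ?_
          have h := abs_sub_rpow_le_integral hf' hf'' hp (u - 1)
          rw [sub_add_cancel] at h
          rwa [hP, intervalIntegral.integral_interval_sub_left (hint _ _) (hint _ _)]
      _ = _ := by
          rw [intervalIntegral.integral_sub (hPi _ _)
            (Continuous.intervalIntegrable (by fun_prop) _ _),
            intervalIntegral.integral_comp_sub_right P 1]
          push_cast
          simp only [add_sub_cancel_right]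
  refine (Finset.sum_le_sum fun j _ => hterm j).trans (le_of_eq ?_)
  rw [Finset.sum_range_sub fun j : ℕ => ∫ u in (j : ℝ) - 1..(j : ℝ), P u]
  have hfirst : ∫ u in ((0 : ℕ) : ℝ) - 1..((0 : ℕ) : ℝ), P u = 0 := by
    refine intervalIntegral.integral_zero_ae (Filter.Eventually.of_forall fun x hx => ?_)
    rw [Set.uIoc_of_le (by linarith)] at hx
    exact hPleft x (by simpa using hx.2)
  have hlast : ∫ u in ((k + 1 : ℕ) : ℝ) - 1..((k + 1 : ℕ) : ℝ), P u = P k := by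
    push_cast
    rw [add_sub_cancel_right]
    calc ∫ u in (k : ℝ)..k + 1, P u = ∫ _ in (k : ℝ)..k + 1, P k := by
          refine intervalIntegral.integral_congr fun u hu => ?_
          rw [Set.uIcc_of_le (by linarith)] at hu
          exact hPright u hu.1
      _ = P k := by simp
  rw [hfirst, hlast, sub_zero]

/-- A function that is constant on a set has zero second derivative on the closure of the interior
of that set, if that second derivative is continuous. -/
theorem deriv_deriv_eq_zero_of_mem_closure_interior {f : ℝ → ℝ} {s : Set ℝ} {c : ℝ}
    (hc : Continuous (deriv (deriv f))) (hf : ∀ x ∈ s, f x = c) {x : ℝ}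
    (hx : x ∈ closure (interior s)) : deriv (deriv f) x = 0 := by
  have hopen : Set.EqOn (deriv (deriv f)) (fun _ => 0) (interior s) := by
    intro y hy
    have h : f =ᶠ[nhds y] fun _ => c :=
      Filter.mem_of_superset (mem_interior_iff_mem_nhds.1 hy) hf
    rw [h.deriv.deriv_eq]
    simp
  exact hopen.closure hc continuous_const hx

/-- Decay of the ghost force with blending width, p < ∞. -/
theorem ghost_force_decay_lp
    (ε : ℝ) (hε : 0 < ε) (k : ℕ) (hk : 1 ≤ k)
    (γs : ℝ → ℝ) (hγs : ContDiff ℝ 2 γs) (hγ01 : ∀ x, γs x ∈ Set.Icc (0 : ℝ) 1)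
    (hγ0 : ∀ x ≤ (0 : ℝ), γs x = 0) (hγ1 : ∀ x, (1 : ℝ) ≤ x → γs x = 1)
    (i : ℤ) (γJ : ℤ → ℝ) (hγJ : γJ = fun ξ => γs ((ξ - i : ℤ) / (k : ℝ)))
    (p : ℝ) (hp : 1 ≤ p) :
    (ε * ∑ ξ ∈ Finset.Icc i (i + k),
        |γJ (ξ + 1) - 2 * γJ ξ + γJ (ξ - 1)| ^ p) ^ (1 / p) ≤
      ε ^ (1 / p) * (k : ℝ) ^ (1 / p - 2) *
        (∫ s in (0 : ℝ)..1, |deriv (deriv γs) s| ^ p) ^ (1 / p) := by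
  have hk0 : (0 : ℝ) < k := by exact_mod_cast hk
  have hp0 : p ≠ 0 := by linarith
  have hγ' : ContDiff ℝ 1 (deriv γs) := (contDiff_succ_iff_deriv.1 hγs).2.2
  have hγ'' : Continuous (deriv (deriv γs)) := hγ'.continuous_deriv le_rfl
  have hf : ∀ x, HasDerivAt (fun x => γs (x / k)) (deriv γs (x / k) / k) x := fun x => by
    simpa [div_eq_mul_inv, Function.comp_def] using
      ((hγs.differentiable (by norm_num) (x / k)).hasDerivAt).comp x
        ((hasDerivAt_id x).div_const (k : ℝ))
  have hf' : ∀ x, HasDerivAt (fun x => deriv γs (x / k) / k)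
      (deriv (deriv γs) (x / k) / k / k) x := fun x => by
    simpa [div_eq_mul_inv, Function.comp_def] using
      (((hγ'.differentiable (by norm_num) (x / k)).hasDerivAt).comp x
        ((hasDerivAt_id x).div_const (k : ℝ))).div_const (k : ℝ)
  have hmain := sum_abs_second_difference_rpow_le (k := k) hf hf' (by fun_prop)
    (fun x hx => by
      rw [deriv_deriv_eq_zero_of_mem_closure_interior (s := Set.Iic 0) hγ'' hγ0]
      · simp
      · simpa using div_nonpos_of_nonpos_of_nonneg hx hk0.le)
    (fun x hx => by
      rw [deriv_deriv_eq_zero_of_mem_closure_interior (s := Set.Ici 1) hγ'' hγ1]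
      · simp
      · simpa using (one_le_div hk0).2 hx) hp
  have hsum : ∑ ξ ∈ Finset.Icc i (i + k), |γJ (ξ + 1) - 2 * γJ ξ + γJ (ξ - 1)| ^ p =
      ∑ j ∈ Finset.range (k + 1), |γs (((j : ℝ) + 1) / k) - 2 * γs ((j : ℝ) / k) +
        γs (((j : ℝ) - 1) / k)| ^ p := by
    symm
    refine Finset.sum_bij (fun j _ => i + (j : ℤ)) ?_ ?_ ?_ ?_
    · intro j hj
      simp only [Finset.mem_range, Finset.mem_Icc] at hj ⊢
      omega
    · intro a _ b _ h
      simpa using h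
    · intro ξ hξ
      simp only [Finset.mem_range, Finset.mem_Icc] at hξ ⊢
      exact ⟨(ξ - i).toNat, by omega, by omega⟩
    · intro j _
      rw [hγJ]
      push_cast
      ring_nf
  set I := ∫ s in (0 : ℝ)..1, |deriv (deriv γs) s| ^ p with hI
  have hI0 : 0 ≤ I := intervalIntegral.integral_nonneg zero_le_one fun x _ => by positivity
  have hscale : ∫ x in (0 : ℝ)..k, |deriv (deriv γs) (x / k) / k / k| ^ p =
      (k : ℝ) ^ (1 - 2 * p) * I := by
    have hpt : ∀ x : ℝ, |deriv (deriv γs) (x / k) / k / k| ^ p =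
        (k : ℝ) ^ (-(2 * p)) * |deriv (deriv γs) (x / k)| ^ p := fun x => by
      rw [div_div, abs_div, abs_of_pos (mul_pos hk0 hk0), Real.div_rpow (abs_nonneg _)
        (by positivity), Real.rpow_neg hk0.le, Real.rpow_mul hk0.le, Real.rpow_two, sq,
        div_eq_inv_mul]
    simp_rw [hpt]
    rw [intervalIntegral.integral_const_mul,
      intervalIntegral.integral_comp_div (fun s => |deriv (deriv γs) s| ^ p) hk0.ne',
      zero_div, div_self hk0.ne', ← hI, sub_eq_neg_add, Real.rpow_add hk0, Real.rpow_one,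
      smul_eq_mul, mul_assoc]
  rw [hscale] at hmain
  rw [hsum]
  calc _ ≤ (ε * ((k : ℝ) ^ (1 - 2 * p) * I)) ^ (1 / p) := by gcongr
    _ = _ := by
      rw [Real.mul_rpow hε.le (by positivity), Real.mul_rpow (by positivity) hI0,
        ← Real.rpow_mul hk0.le, mul_assoc]
      congr 4
      field_simp
end

section
/- (Decay of the coupling error with blending width.) Let k ≥ 1 be an integer, let β_s : ℝ → [0,1] be continuously differentiable with β_s(x) = 0 for all x ≤ 0 and β_s(x) = 1 for all x ≥ 1, let i ∈ ℤ, and define β_J(ξ) := β_s((ξ − i)/k) for ξ ∈ ℤ. Then for every p ∈ [1,∞), ( ε Σ_{ξ=i}^{i+k} |Δβ_J(ξ)|^p )^{1/p} ≤ ε^{1/p} k^{1/p − 1} ( ∫₀¹ |β_s'(s)|^p ds )^{1/p}. -/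
open scoped BigOperators

/-- Jensen's inequality for the fundamental theorem of calculus. -/
lemma abs_sub_rpow_le_mul_integral_deriv {f : ℝ → ℝ} (hf : ContDiff ℝ 1 f) {a b p : ℝ}
    (hab : a < b) (hp : 1 ≤ p) :
    |f b - f a| ^ p ≤ (b - a) ^ (p - 1) * ∫ s in a..b, |deriv f s| ^ p := by
  have hd : Continuous (deriv f) := hf.continuous_deriv le_rfl
  have hdp : Continuous fun s => |deriv f s| ^ p :=
    hd.abs.rpow_const fun _ => Or.inr (by linarith)
  have hpos : 0 < b - a := sub_pos.2 hab
  have hftc : f b - f a = ∫ s in a..b, deriv f s :=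
    (intervalIntegral.integral_deriv_eq_sub
      (fun x _ => (hf.differentiable one_ne_zero).differentiableAt)
      (hd.intervalIntegrable a b)).symm
  have habs : |f b - f a| ≤ ∫ s in a..b, |deriv f s| := by
    rw [hftc]
    exact intervalIntegral.abs_integral_le_integral_abs hab.le
  have hjensen : ((b - a)⁻¹ * ∫ s in a..b, |deriv f s|) ^ p ≤
      (b - a)⁻¹ * ∫ s in a..b, |deriv f s| ^ p := by
    have h := (convexOn_rpow hp).map_set_average_le
      (μ := MeasureTheory.volume) (t := Set.uIoc a b) (f := fun s => |deriv f s|)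
      (continuousOn_id.rpow_const fun _ _ => Or.inr (by linarith)) isClosed_Ici
      (by simp [Set.uIoc_of_le hab.le, hab])
      (by simp [Set.uIoc_of_le hab.le])
      (Filter.Eventually.of_forall fun _ => Set.mem_Ici.2 (abs_nonneg _))
      (intervalIntegrable_iff.1 (hd.abs.intervalIntegrable a b))
      (intervalIntegrable_iff.1 (hdp.intervalIntegrable a b))
    simpa only [interval_average_eq, smul_eq_mul, Function.comp_def] using h
  have hint : 0 ≤ ∫ s in a..b, |deriv f s| :=
    intervalIntegral.integral_nonneg hab.le fun _ _ => abs_nonneg _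
  rw [Real.mul_rpow (inv_nonneg.2 hpos.le) hint, Real.inv_rpow hpos.le,
    inv_mul_le_iff₀ (Real.rpow_pos_of_pos hpos p), ← mul_assoc, ← div_eq_mul_inv,
    ← Real.rpow_sub_one hpos.ne'] at hjensen
  exact (Real.rpow_le_rpow (abs_nonneg _) habs (by linarith)).trans hjensen

/-- The `p`-th power sum of increments over a uniform partition of `[0, 1]`. -/
lemma sum_abs_sub_rpow_le_integral_deriv {f : ℝ → ℝ} (hf : ContDiff ℝ 1 f) {k : ℕ} (hk : 1 ≤ k)
    {p : ℝ} (hp : 1 ≤ p) :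
    ∑ j ∈ Finset.range k, |f (((j + 1 : ℕ) : ℝ) / k) - f ((j : ℝ) / k)| ^ p ≤
      (k : ℝ) ^ (1 - p) * ∫ s in (0 : ℝ)..1, |deriv f s| ^ p := by
  have hk0 : (0 : ℝ) < k := by exact_mod_cast hk
  have hdp : Continuous fun s => |deriv f s| ^ p :=
    (hf.continuous_deriv le_rfl).abs.rpow_const fun _ => Or.inr (by linarith)
  have hadj := intervalIntegral.sum_integral_adjacent_intervals (n := k)
    (a := fun j : ℕ => (j : ℝ) / k) (μ := MeasureTheory.volume)
    fun j _ => hdp.intervalIntegrable _ _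
  simp only [Nat.cast_zero, zero_div, div_self hk0.ne'] at hadj
  rw [← hadj, Finset.mul_sum]
  refine Finset.sum_le_sum fun j _ => ?_
  have hstep : ((j + 1 : ℕ) : ℝ) / k - (j : ℝ) / k = (k : ℝ)⁻¹ := by
    push_cast; ring
  have h := abs_sub_rpow_le_mul_integral_deriv hf (p := p)
    (sub_pos.1 (hstep ▸ inv_pos.2 hk0)) hp
  rwa [hstep, Real.inv_rpow hk0.le, ← Real.rpow_neg hk0.le, neg_sub] at h

lemma sum_Icc_int_eq_sum_range (g : ℤ → ℝ) (i : ℤ) (n : ℕ) :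
    ∑ ξ ∈ Finset.Icc i (i + n), g ξ = ∑ j ∈ Finset.range (n + 1), g (i + j) := by
  refine Finset.sum_nbij' (fun ξ => (ξ - i).toNat) (fun j => i + j) ?_ ?_ ?_ ?_ ?_
  · intro ξ hξ; simp at hξ ⊢; omega
  · intro j hj; simp at hj ⊢; omega
  · intro ξ hξ; simp at hξ ⊢; omega
  · intro j _; simp
  · intro ξ hξ
    simp at hξ
    congr 1
    omega

/-- Decay of the coupling error with blending width. -/
theorem coupling_error_decay_lp
    (ε : ℝ) (hε : 0 < ε) (k : ℕ) (hk : 1 ≤ k)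
    (βs : ℝ → ℝ) (hβs : ContDiff ℝ 1 βs) (hβ01 : ∀ x, βs x ∈ Set.Icc (0 : ℝ) 1)
    (hβ0 : ∀ x ≤ (0 : ℝ), βs x = 0) (hβ1 : ∀ x, (1 : ℝ) ≤ x → βs x = 1)
    (i : ℤ) (βJ : ℤ → ℝ) (hβJ : βJ = fun ξ => βs ((ξ - i : ℤ) / (k : ℝ)))
    (p : ℝ) (hp : 1 ≤ p) :
    (ε * ∑ ξ ∈ Finset.Icc i (i + k), |βJ ξ - βJ (ξ - 1)| ^ p) ^ (1 / p) ≤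
      ε ^ (1 / p) * (k : ℝ) ^ (1 / p - 1) *
        (∫ s in (0 : ℝ)..1, |deriv βs s| ^ p) ^ (1 / p) := by
  have hp0 : 0 < p := by linarith
  have hk0 : (0 : ℝ) < k := by exact_mod_cast hk
  have hfirst : βJ (i + (0 : ℕ)) - βJ (i + (0 : ℕ) - 1) = 0 := by
    have hneg : (-1 : ℝ) / k ≤ 0 := div_nonpos_of_nonpos_of_nonneg (by norm_num) hk0.le
    simp [hβJ, hβ0 0 le_rfl, hβ0 _ hneg]
  have hsum : ∑ ξ ∈ Finset.Icc i (i + k), |βJ ξ - βJ (ξ - 1)| ^ p =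
      ∑ j ∈ Finset.range k, |βs (((j + 1 : ℕ) : ℝ) / k) - βs ((j : ℝ) / k)| ^ p := by
    rw [sum_Icc_int_eq_sum_range (fun ξ => |βJ ξ - βJ (ξ - 1)| ^ p), Finset.sum_range_succ',
      hfirst, abs_zero, Real.zero_rpow hp0.ne', add_zero]
    refine Finset.sum_congr rfl fun j _ => ?_
    have hright : i + ((j + 1 : ℕ) : ℤ) - i = ((j + 1 : ℕ) : ℤ) := by ring
    have hleft : i + ((j + 1 : ℕ) : ℤ) - 1 - i = (j : ℤ) := by push_cast; ring
    simp only [hβJ, hright, hleft, Int.cast_natCast]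
  have hI : 0 ≤ ∫ s in (0 : ℝ)..1, |deriv βs s| ^ p :=
    intervalIntegral.integral_nonneg zero_le_one fun _ _ => by positivity
  have hexp : (1 - p) * (1 / p) = 1 / p - 1 := by field_simp
  rw [hsum, Real.mul_rpow hε.le (Finset.sum_nonneg fun _ _ => by positivity), mul_assoc,
    ← hexp, Real.rpow_mul hk0.le, ← Real.mul_rpow (by positivity) hI]
  gcongr
  exact sum_abs_sub_rpow_le_integral_deriv hβs hk hp
end
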